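/- arXiv:2309.04735 — 6 statements merged into one kernel-verified Lean document; each statement's English description precedes it below -/
import Mathlib

section
/- Let β and γ be real numbers with γ < 0 and 1 ≤ β + γ ≤ 2. Then for every graph G, the univariate partition-function polynomial Z_G(x) has no zero in the open complex disk {z ∈ ℂ : |z| < (β−1)/(1−γ)}. -/
open scoped BigOperators

/-- A finite undirected multigraph (self-loops and parallel edges permitted),
with vertices `Fin n` and edges given as a multiset of (ordered representatives of)
unordered pairs of vertices.  Since the edge weight below is symmetric, the
orientation of each pair is immaterial. -/
structure MultiGraph where
  n : ℕ
  edges : Multiset (Fin n × Fin n)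

/-- The edge interaction: `A₀₀ = β`, `A₀₁ = A₁₀ = 1`, `A₁₁ = γ`
(spin `false` = 0, spin `true` = 1). -/
noncomputable def edgeW (β γ : ℝ) (i j : Bool) : ℂ :=
  if i = j then (if i then (γ : ℂ) else (β : ℂ)) else 1

/-- The partition function with complex external fields `lam`. -/
noncomputable def ZC (β γ : ℝ) (G : MultiGraph) (lam : Fin G.n → ℂ) : ℂ :=
  ∑ σ : Fin G.n → Bool,
    (G.edges.map fun e => edgeW β γ (σ e.1) (σ e.2)).prod *
      ∏ v, (if σ v then lam v else 1)

namespace TwoSpin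

open Finset Function

/-- A complex quadratic whose middle coefficient dominates has a root in the open unit disk. -/
lemma exists_quadratic_root_norm_lt_one {a s D : ℂ} (h : ‖a‖ + ‖D‖ < ‖s‖) :
    ∃ u : ℂ, ‖u‖ < 1 ∧ a + u * s + u * u * D = 0 := by
  have hs : s ≠ 0 := by
    rintro rfl
    have := norm_nonneg a
    have := norm_nonneg D
    simp only [norm_zero] at h
    linarith
  by_cases hD : D = 0
  · refine ⟨-a / s, ?_, ?_⟩
    · rw [norm_div, norm_neg, div_lt_one (norm_pos_iff.2 hs)]
      have := norm_nonneg D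
      linarith
    · subst hD
      field_simp
      ring
  · obtain ⟨δ, hδ⟩ := IsAlgClosed.exists_pow_nat_eq (s ^ 2 - 4 * a * D) (n := 2) (by norm_num)
    set u₁ := (-s + δ) / (2 * D) with hu₁
    set u₂ := (-s - δ) / (2 * D) with hu₂
    have hsum : s = -(D * (u₁ + u₂)) := by
      rw [hu₁, hu₂]
      field_simp
      ring
    have hprod : a = D * (u₁ * u₂) := by
      rw [hu₁, hu₂]
      field_simp
      linear_combination hδ
    by_cases h₁ : ‖u₁‖ < 1
    · refine ⟨u₁, h₁, ?_⟩
      linear_combination hprod + u₁ * hsum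
    by_cases h₂ : ‖u₂‖ < 1
    · refine ⟨u₂, h₂, ?_⟩
      linear_combination hprod + u₂ * hsum
    exfalso
    have hs' : ‖s‖ ≤ ‖D‖ * (‖u₁‖ + ‖u₂‖) := by
      rw [hsum, norm_neg, norm_mul]
      gcongr
      exact norm_add_le _ _
    have ha' : ‖a‖ = ‖D‖ * (‖u₁‖ * ‖u₂‖) := by
      rw [hprod, norm_mul, norm_mul]
    have hDpos := norm_pos_iff.2 hD
    push Not at h₁ h₂
    nlinarith [mul_nonneg hDpos.le (mul_nonneg (sub_nonneg.2 h₁) (sub_nonneg.2 h₂))]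

lemma exists_norm_one_mul_eq_norm (b : ℂ) : ∃ e : ℂ, ‖e‖ = 1 ∧ e * b = ‖b‖ := by
  by_cases hb : b = 0
  · exact ⟨1, by simp [hb]⟩
  · have hb' : (‖b‖ : ℂ) ≠ 0 := by exact_mod_cast norm_ne_zero_iff.2 hb
    refine ⟨‖b‖ / b, ?_, by field_simp⟩
    rw [norm_div, Complex.norm_real, norm_norm, div_self (norm_ne_zero_iff.2 hb)]

lemma mul_norm_le_of_linear_ne_zero {ρ : ℝ} {a b : ℂ}
    (h : ∀ x : ℂ, ‖x‖ < ρ → a + x * b ≠ 0) : ρ * ‖b‖ ≤ ‖a‖ := by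
  by_contra! hlt
  have hb : b ≠ 0 := by
    rintro rfl
    have := norm_nonneg a
    simp only [norm_zero, mul_zero] at hlt
    linarith
  refine h (-a / b) ?_ (by field_simp; ring)
  rwa [norm_div, norm_neg, div_lt_iff₀ (norm_pos_iff.2 hb)]

/-- Coefficient bound for a bi-affine polynomial without zeros in a bidisk. -/
lemma add_norm_le_of_biaffine_ne_zero {ρ₁ ρ₂ : ℝ} (hρ₁ : 0 < ρ₁) (hρ₂ : 0 < ρ₂) {a b c d : ℂ}
    (h : ∀ x y : ℂ, ‖x‖ < ρ₁ → ‖y‖ < ρ₂ → a + x * b + y * c + x * y * d ≠ 0) :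
    ρ₁ * ‖b‖ + ρ₂ * ‖c‖ ≤ ‖a‖ + ρ₁ * ρ₂ * ‖d‖ := by
  by_contra! hlt
  obtain ⟨e₁, he₁, hb⟩ := exists_norm_one_mul_eq_norm b
  obtain ⟨e₂, he₂, hc⟩ := exists_norm_one_mul_eq_norm c
  have hD : ‖(ρ₁ * e₁) * (ρ₂ * e₂) * d‖ = ρ₁ * ρ₂ * ‖d‖ := by
    simp [he₁, he₂, abs_of_pos hρ₁, abs_of_pos hρ₂]
  have hs : ‖((ρ₁ * ‖b‖ + ρ₂ * ‖c‖ : ℝ) : ℂ)‖ = ρ₁ * ‖b‖ + ρ₂ * ‖c‖ := by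
    rw [Complex.norm_real, Real.norm_of_nonneg (by positivity)]
  obtain ⟨u, hu, hroot⟩ := exists_quadratic_root_norm_lt_one
    (a := a) (s := ((ρ₁ * ‖b‖ + ρ₂ * ‖c‖ : ℝ) : ℂ)) (D := (ρ₁ * e₁) * (ρ₂ * e₂) * d)
    (by rw [hD, hs]; exact hlt)
  refine h (ρ₁ * e₁ * u) (ρ₂ * e₂ * u) ?_ ?_ ?_
  · simpa [he₁, abs_of_pos hρ₁] using mul_lt_of_lt_one_right hρ₁ hu
  · simpa [he₂, abs_of_pos hρ₂] using mul_lt_of_lt_one_right hρ₂ hu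
  · push_cast at hroot
    linear_combination hroot + ρ₁ * u * hb + ρ₂ * u * hc

/-- Adding an edge between two distinct vertices preserves zero-freeness, provided the
coefficients satisfy the bound coming from identifying the two vertices. -/
lemma biaffine_edge_ne_zero {β γ r ρ₁ ρ₂ : ℝ} (hβ : 1 < β) (hγ : γ < 0)
    (hr : β - 1 = r * (1 - γ)) (hρ₁ : 0 < ρ₁) (hρ₂ : 0 < ρ₂) {a b c d : ℂ}
    (h : ∀ x y : ℂ, ‖x‖ < ρ₁ → ‖y‖ < ρ₂ → a + x * b + y * c + x * y * d ≠ 0)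
    (hd : ρ₁ * ρ₂ * ‖d‖ ≤ r * ‖a‖) {x y : ℂ} (hx : ‖x‖ < ρ₁) (hy : ‖y‖ < ρ₂) :
    β * a + x * b + y * c + x * y * (γ * d) ≠ 0 := by
  intro h0
  have ha : 0 < ‖a‖ := norm_pos_iff.2 (by simpa using h 0 0 (by simpa) (by simpa))
  have hbc := add_norm_le_of_biaffine_ne_zero hρ₁ hρ₂ h
  have hle : β * ‖a‖ ≤ ‖x‖ * ‖b‖ + ‖y‖ * ‖c‖ + ‖x‖ * ‖y‖ * (-γ * ‖d‖) := by
    have heq : (β : ℂ) * a = -(x * b + y * c + x * y * (γ * d)) := by linear_combination h0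
    calc β * ‖a‖ = ‖(β : ℂ) * a‖ := by
          rw [norm_mul, Complex.norm_real, Real.norm_of_nonneg (by linarith)]
      _ ≤ ‖x * b‖ + ‖y * c‖ + ‖x * y * (γ * d)‖ := by rw [heq, norm_neg]; exact norm_add₃_le
      _ = _ := by simp only [norm_mul, Complex.norm_real, Real.norm_of_nonpos hγ.le]
  have hxb : ‖x‖ * ‖b‖ ≤ ρ₁ * ‖b‖ := by gcongr
  have hyc : ‖y‖ * ‖c‖ ≤ ρ₂ * ‖c‖ := by gcongr
  have hγd : 0 ≤ -γ * ‖d‖ := mul_nonneg (by linarith) (norm_nonneg d)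
  have hxy : ‖x‖ * ‖y‖ * (-γ * ‖d‖) ≤ ρ₁ * ρ₂ * (-γ * ‖d‖) := by gcongr
  have hd' : (1 - γ) * (ρ₁ * ρ₂ * ‖d‖) ≤ (1 - γ) * (r * ‖a‖) :=
    mul_le_mul_of_nonneg_left hd (by linarith)
  have hra : (1 - γ) * (r * ‖a‖) = (β - 1) * ‖a‖ := by rw [hr]; ring
  have hb0 : ‖b‖ = 0 := by
    by_contra hne
    have : ‖x‖ * ‖b‖ < ρ₁ * ‖b‖ :=
      mul_lt_mul_of_pos_right hx (lt_of_le_of_ne (norm_nonneg b) (Ne.symm hne))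
    nlinarith
  have hc0 : ‖c‖ = 0 := by
    by_contra hne
    have : ‖y‖ * ‖c‖ < ρ₂ * ‖c‖ :=
      mul_lt_mul_of_pos_right hy (lt_of_le_of_ne (norm_nonneg c) (Ne.symm hne))
    nlinarith
  rw [hb0, hc0] at hle
  have hd0 : 0 ≤ ρ₁ * ρ₂ * ‖d‖ := by positivity
  nlinarith

lemma prod_field_update {V : Type*} [DecidableEq V] (lam : V → ℂ) (S : Finset V)
    (σ : V → Bool) {v : V} (hv : v ∉ S) (i : Bool) :
    ∏ k ∈ S, (if update σ v i k then lam k else 1) = ∏ k ∈ S, (if σ k then lam k else 1) := by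
  refine prod_congr rfl fun k hk => ?_
  rw [update_of_ne (ne_of_mem_of_not_mem hk hv)]

section Spin

variable {V : Type*} [Fintype V] [DecidableEq V]

/-- Partition function of an arbitrary configuration weight `w` with external fields `lam`. -/
noncomputable def partition (w : (V → Bool) → ℂ) (lam : V → ℂ) : ℂ :=
  ∑ σ : V → Bool, w σ * ∏ v, (if σ v then lam v else 1)

/-- Weight of a configuration given by a multiset of edges. -/
noncomputable def edgesWeight (β γ : ℝ) (E : Multiset (V × V)) (σ : V → Bool) : ℂ :=
  (E.map fun e => edgeW β γ (σ e.1) (σ e.2)).prod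

/-- Twice the part of the partition function with spin `i` at `v`, without the field at `v`. -/
noncomputable def coeffOne (w : (V → Bool) → ℂ) (lam : V → ℂ) (v : V) (i : Bool) : ℂ :=
  ∑ σ : V → Bool, w (update σ v i) * ∏ k ∈ univ.erase v, (if σ k then lam k else 1)

/-- Four times the part of the partition function with spins `i` at `u` and `j` at `v`,
without the fields at `u` and `v`. -/
noncomputable def coeffTwo (w : (V → Bool) → ℂ) (lam : V → ℂ) (u v : V) (i j : Bool) : ℂ :=
  ∑ σ : V → Bool, w (update (update σ u i) v j) *
    ∏ k ∈ (univ.erase v).erase u, (if σ k then lam k else 1)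

lemma two_mul_sum_config (v : V) (F : (V → Bool) → ℂ) :
    2 * ∑ σ, F σ = ∑ σ, (F (update σ v false) + F (update σ v true)) := by
  have hinv : Involutive fun σ : V → Bool => update σ v (!σ v) := fun σ => by simp
  have hflip : ∑ σ, F (update σ v (!σ v)) = ∑ σ, F σ :=
    hinv.toPerm.sum_comp univ F (by simp)
  rw [two_mul]
  nth_rewrite 2 [← hflip]
  rw [← sum_add_distrib]
  refine sum_congr rfl fun σ _ => ?_
  have hσ := update_eq_self v σ
  cases h : σ v
  · rw [h] at hσ
    rw [hσ]
    rfl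
  · rw [h] at hσ
    rw [hσ, add_comm]
    rfl

lemma two_mul_partition (w : (V → Bool) → ℂ) (lam : V → ℂ) (v : V) :
    2 * partition w lam = coeffOne w lam v false + lam v * coeffOne w lam v true := by
  unfold partition coeffOne
  rw [two_mul_sum_config v, mul_sum, ← sum_add_distrib]
  refine sum_congr rfl fun σ _ => ?_
  rw [← mul_prod_erase univ _ (mem_univ v), ← mul_prod_erase univ _ (mem_univ v),
    prod_field_update lam _ σ (by simp), prod_field_update lam _ σ (by simp)]
  simp
  ring

lemma two_mul_coeffOne (w : (V → Bool) → ℂ) (lam : V → ℂ) {u v : V} (huv : u ≠ v) (j : Bool) :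
    2 * coeffOne w lam v j =
      coeffTwo w lam u v false j + lam u * coeffTwo w lam u v true j := by
  unfold coeffOne coeffTwo
  rw [two_mul_sum_config u, mul_sum, ← sum_add_distrib]
  refine sum_congr rfl fun σ _ => ?_
  have hu : u ∈ univ.erase v := by simp [huv]
  rw [← mul_prod_erase _ _ hu, ← mul_prod_erase _ _ hu,
    prod_field_update lam _ σ (by simp), prod_field_update lam _ σ (by simp)]
  simp
  ring

lemma four_mul_partition (w : (V → Bool) → ℂ) (lam : V → ℂ) {u v : V} (huv : u ≠ v) :
    4 * partition w lam = coeffTwo w lam u v false false + lam u * coeffTwo w lam u v true false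
      + lam v * coeffTwo w lam u v false true
      + lam u * lam v * coeffTwo w lam u v true true := by
  linear_combination 2 * two_mul_partition w lam v + two_mul_coeffOne w lam huv false
    + lam v * two_mul_coeffOne w lam huv true

lemma coeffOne_congr (w : (V → Bool) → ℂ) {lam mu : V → ℂ} (v : V) (i : Bool)
    (h : ∀ k, k ≠ v → lam k = mu k) : coeffOne w lam v i = coeffOne w mu v i := by
  unfold coeffOne
  refine sum_congr rfl fun σ _ => ?_
  congr 1
  refine prod_congr rfl fun k hk => ?_
  rw [h k (ne_of_mem_erase hk)]

lemma coeffTwo_congr (w : (V → Bool) → ℂ) {lam mu : V → ℂ} (u v : V) (i j : Bool)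
    (h : ∀ k, k ≠ u → k ≠ v → lam k = mu k) : coeffTwo w lam u v i j = coeffTwo w mu u v i j := by
  unfold coeffTwo
  refine sum_congr rfl fun σ _ => ?_
  congr 1
  refine prod_congr rfl fun k hk => ?_
  rw [h k (ne_of_mem_erase hk) (ne_of_mem_erase (mem_of_mem_erase hk))]

lemma coeffOne_cons_loop (β γ : ℝ) (E : Multiset (V × V)) (lam : V → ℂ) (v : V) (i : Bool) :
    coeffOne (edgesWeight β γ ((v, v) ::ₘ E)) lam v i =
      edgeW β γ i i * coeffOne (edgesWeight β γ E) lam v i := by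
  simp [coeffOne, edgesWeight, mul_sum, mul_assoc]

lemma coeffTwo_cons (β γ : ℝ) (E : Multiset (V × V)) (lam : V → ℂ) {u v : V} (huv : u ≠ v)
    (i j : Bool) :
    coeffTwo (edgesWeight β γ ((u, v) ::ₘ E)) lam u v i j =
      edgeW β γ i j * coeffTwo (edgesWeight β γ E) lam u v i j := by
  simp [coeffTwo, edgesWeight, mul_sum, mul_assoc, update_of_ne huv]

/-- Redirect every edge end at `v` to `u`. -/
def mergeEdges (u v : V) (E : Multiset (V × V)) : Multiset (V × V) :=
  E.map (Prod.map (update id v u) (update id v u))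

lemma coeffTwo_mergeEdges (β γ : ℝ) (E : Multiset (V × V)) (lam : V → ℂ) {u v : V} (huv : u ≠ v)
    (i : Bool) :
    coeffTwo (edgesWeight β γ (mergeEdges u v E)) lam u v i false =
      coeffTwo (edgesWeight β γ E) lam u v i i := by
  unfold coeffTwo
  refine sum_congr rfl fun σ _ => ?_
  congr 1
  have hσ : ∀ k, update (update σ u i) v false (update id v u k) =
      update (update σ u i) v i k := by
    intro k
    by_cases hk : k = v
    · subst hk
      simp [update_of_ne huv]
    · simp [update_of_ne hk]
  simp only [edgesWeight, mergeEdges, Multiset.map_map, comp_apply, Prod.map_fst, Prod.map_snd, hσ]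

lemma partition_one (lam : V → ℂ) : partition (fun _ => 1) lam = ∏ v, (1 + lam v) := by
  have h : ∀ v, 1 + lam v = ∑ b : Bool, if b then lam v else 1 := by
    intro v
    simp [add_comm]
  simp only [partition, one_mul, h]
  rw [prod_univ_sum, Fintype.piFinset_univ]

/-- One field lies in the open unit disk and all the others in the open disk of radius `r`. -/
def Admissible (r : ℝ) (lam : V → ℂ) : Prop :=
  ∃ p, ∀ k, ‖lam k‖ < if k = p then 1 else r

theorem partition_edgesWeight_ne_zero {β γ r : ℝ} (hβ : 1 < β) (hγ : γ < 0) (hβγ : 0 ≤ β + γ)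
    (hr : β - 1 = r * (1 - γ)) (hr₀ : 0 < r) (hr₁ : r ≤ 1) (E : Multiset (V × V)) {lam : V → ℂ}
    (hlam : Admissible r lam) : partition (edgesWeight β γ E) lam ≠ 0 := by
  induction hm : Multiset.card E generalizing E lam with
  | zero =>
    rw [Multiset.card_eq_zero] at hm
    subst hm
    have h1 : edgesWeight β γ (0 : Multiset (V × V)) = fun _ => 1 := by
      ext σ
      simp [edgesWeight]
    rw [h1, partition_one, prod_ne_zero_iff]
    intro v _ h0
    obtain ⟨p, hp⟩ := hlam
    have hv := (hp v).trans_le (b := if v = p then 1 else r) (c := 1) (by split_ifs <;> linarith)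
    rw [show lam v = -1 by linear_combination h0] at hv
    simp at hv
  | succ m ih =>
    obtain ⟨⟨u, v⟩, E, rfl⟩ := Multiset.card_pos_iff_exists_mem.1 (by omega : 0 < Multiset.card E)
      |>.imp fun a ha => Multiset.exists_cons_of_mem ha
    rw [Multiset.card_cons, Nat.add_right_cancel_iff] at hm
    obtain ⟨p, hp⟩ := hlam
    set ρ : V → ℝ := fun k => if k = p then 1 else r with hρ
    have hρ₀ : ∀ k, 0 < ρ k := fun k => by
      simp only [hρ]
      split_ifs <;> linarith
    intro h0
    by_cases huv : u = v
    · subst huv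
      have hlin : ∀ x : ℂ, ‖x‖ < ρ u → coeffOne (edgesWeight β γ E) lam u false +
          x * coeffOne (edgesWeight β γ E) lam u true ≠ 0 := by
        intro x hx h
        refine ih E (lam := update lam u x) ⟨p, fun k => ?_⟩ hm ?_
        · by_cases hk : k = u
          · subst hk
            simpa using hx
          · simpa [update_of_ne hk] using hp k
        · have hmu : ∀ i, coeffOne (edgesWeight β γ E) (update lam u x) u i =
              coeffOne (edgesWeight β γ E) lam u i := fun i =>
            coeffOne_congr _ u i fun k hk => update_of_ne hk _ _
          have h2 := two_mul_partition (edgesWeight β γ E) (update lam u x) u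
          rw [hmu, hmu, update_self, h] at h2
          simpa using h2
      have h2 := two_mul_partition (edgesWeight β γ ((u, u) ::ₘ E)) lam u
      rw [h0, coeffOne_cons_loop, coeffOne_cons_loop] at h2
      set a := coeffOne (edgesWeight β γ E) lam u false
      set b := coeffOne (edgesWeight β γ E) lam u true
      have hβ' : (β : ℂ) ≠ 0 := by
        norm_cast
        linarith
      refine hlin (lam u * (γ / β)) ?_ ?_
      · have hle : ‖(γ / β : ℂ)‖ ≤ 1 := by
          rw [norm_div, Complex.norm_real, Complex.norm_real, Real.norm_of_nonpos hγ.le,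
            Real.norm_of_nonneg (by linarith), div_le_one (by linarith)]
          linarith
        rw [norm_mul]
        exact (mul_le_of_le_one_right (norm_nonneg _) hle).trans_lt (hp u)
      · simp only [edgeW, if_true, Bool.false_eq_true, if_false, mul_zero] at h2
        field_simp
        linear_combination -h2
    · have hbi : ∀ x y : ℂ, ‖x‖ < ρ u → ‖y‖ < ρ v →
          coeffTwo (edgesWeight β γ E) lam u v false false
            + x * coeffTwo (edgesWeight β γ E) lam u v true false
            + y * coeffTwo (edgesWeight β γ E) lam u v false true
            + x * y * coeffTwo (edgesWeight β γ E) lam u v true true ≠ 0 := by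
        intro x y hx hy h
        have hmu : ∀ i j, coeffTwo (edgesWeight β γ E) (update (update lam u x) v y) u v i j =
            coeffTwo (edgesWeight β γ E) lam u v i j := fun i j =>
          coeffTwo_congr _ u v i j fun k hu hv => by rw [update_of_ne hv, update_of_ne hu]
        refine ih E (lam := update (update lam u x) v y) ⟨p, fun k => ?_⟩ hm ?_
        · by_cases hk : k = v
          · subst hk
            simpa using hy
          by_cases hk' : k = u
          · subst hk'
            simpa [update_of_ne hk] using hx
          · simpa [update_of_ne hk, update_of_ne hk'] using hp k
        · have h4 := four_mul_partition (edgesWeight β γ E) (update (update lam u x) v y) huv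
          simp only [hmu, update_self, update_of_ne huv] at h4
          rw [h] at h4
          simpa using h4
      -- The field allowed at the vertex obtained by identifying `u` and `v`.
      set q : V := if p = v then u else p with hq
      have hmerge : ∀ t : ℂ, ‖t‖ < (if u = q then 1 else r) →
          coeffTwo (edgesWeight β γ E) lam u v false false
            + t * coeffTwo (edgesWeight β γ E) lam u v true true ≠ 0 := by
        intro t ht h
        have hmu : ∀ F i j, coeffTwo (edgesWeight β γ F) (update (update lam u t) v 0) u v i j =
            coeffTwo (edgesWeight β γ F) lam u v i j := fun F i j =>
          coeffTwo_congr _ u v i j fun k hu hv => by rw [update_of_ne hv, update_of_ne hu]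
        refine ih (mergeEdges u v E) (lam := update (update lam u t) v 0) ⟨q, fun k => ?_⟩
          (by simpa [mergeEdges] using hm) ?_
        · by_cases hk : k = v
          · subst hk
            simp only [update_self, norm_zero]
            split_ifs <;> linarith
          by_cases hk' : k = u
          · subst hk'
            simpa [update_of_ne hk] using ht
          · rw [update_of_ne hk, update_of_ne hk']
            refine (hp k).trans_le ?_
            have : k = q ↔ k = p := by
              rw [hq]
              split_ifs with hpv
              · simp [hk', hpv, hk]
              · rfl
            simp only [this, le_refl]
        · have h4 := four_mul_partition (edgesWeight β γ (mergeEdges u v E))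
            (update (update lam u t) v 0) huv
          simp only [hmu, update_self, update_of_ne huv, coeffTwo_mergeEdges β γ E lam huv] at h4
          rw [h] at h4
          simpa using h4
      have hd := mul_norm_le_of_linear_ne_zero hmerge
      refine biaffine_edge_ne_zero hβ hγ hr (hρ₀ u) (hρ₀ v) hbi ?_ (hp u) (hp v) ?_
      · have hρρ : ρ u * ρ v = r * (if u = q then 1 else r) := by
          simp only [hρ, hq]
          by_cases hpv : p = v
          · subst hpv
            simp [huv]
          · simp only [Ne.symm hpv, hpv, if_false]
            ring
        rw [hρρ, mul_assoc]
        exact mul_le_mul_of_nonneg_left hd hr₀.le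
      · have h4 := four_mul_partition (edgesWeight β γ ((u, v) ::ₘ E)) lam huv
        simp only [h0, coeffTwo_cons β γ E lam huv, edgeW] at h4
        simp at h4
        linear_combination -h4

end Spin

end TwoSpin

/-- If `γ < 0` and `1 ≤ β + γ ≤ 2`, then for every graph `G` the univariate
partition function `Z_G(x)` has no zero in the open disk of radius `(β-1)/(1-γ)`
around `0`. -/
theorem stmt2 (β γ : ℝ) (hγ : γ < 0) (h1 : 1 ≤ β + γ) (h2 : β + γ ≤ 2)
    (G : MultiGraph) (z : ℂ) (hz : ‖z‖ < (β - 1) / (1 - γ)) :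
    ZC β γ G (fun _ => z) ≠ 0 := by
  have hpos : 0 < 1 - γ := by linarith
  have hr₁ : (β - 1) / (1 - γ) ≤ 1 := by
    rw [div_le_one hpos]
    linarith
  change TwoSpin.partition (TwoSpin.edgesWeight β γ G.edges) (fun _ => z) ≠ 0
  rcases isEmpty_or_nonempty (Fin G.n) with hG | ⟨⟨p⟩⟩
  · have hE : G.edges = 0 := Multiset.eq_zero_of_forall_notMem fun e => hG.elim e.1
    simp [hE, TwoSpin.partition, TwoSpin.edgesWeight]
  · refine TwoSpin.partition_edgesWeight_ne_zero (by linarith) hγ (by linarith)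
      (div_mul_cancel₀ _ hpos.ne').symm (div_pos (by linarith) hpos) hr₁ _ ⟨p, fun k => ?_⟩
    split_ifs
    · exact hz.trans_le hr₁
    · exact hz
end

section
/- Let β and γ be real numbers with γ < 0 and 1 ≤ β + γ ≤ 2, let r = (β−1)/(1−γ) ∈ (0,1], and let K = {z ∈ ℂ : |z| ≤ r} \ {−1}. Then for every graph G, every external field vector λ with λ_v ∈ K for all v ∈ V(G), and every vertex v ∈ V(G): (1) [Z_{G,v}(λ)]₀ ≠ 0, so the ratio R_{G,v}(λ) is well defined, and R_{G,v}(λ) ∈ K; and (2) the partition function Z_G(λ) is nonzero. -/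
open scoped BigOperators

/-- `[Z_{G,v}(λ)]_i` : the partition function restricted to configurations with `σ v = i`. -/
noncomputable def ZCv (β γ : ℝ) (G : MultiGraph) (lam : Fin G.n → ℂ) (v : Fin G.n) (i : Bool) : ℂ :=
  ∑ σ : Fin G.n → Bool,
    if σ v = i then
      (G.edges.map fun e => edgeW β γ (σ e.1) (σ e.2)).prod *
        ∏ u, (if σ u then lam u else 1)
    else 0

open Finset

/-- The closed disc of radius `r` with the point `-1` removed. -/
def puncturedDisc (r : ℝ) : Set ℂ := {z : ℂ | ‖z‖ ≤ r} \ {-1}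

lemma mem_puncturedDisc_of_norm_lt_one {r : ℝ} {z : ℂ} (hz : ‖z‖ ≤ r) (hz1 : ‖z‖ < 1) :
    z ∈ puncturedDisc r := by
  refine ⟨hz, ?_⟩
  rintro rfl
  simp at hz1

lemma ofReal_mem_puncturedDisc {r : ℝ} (hr : 0 < r) : (r : ℂ) ∈ puncturedDisc r := by
  refine ⟨by simp [abs_of_pos hr], fun h => ?_⟩
  have := congrArg Complex.re h
  simp at this
  linarith

lemma exists_norm_add_mul_eq (b d : ℂ) {ρ : ℝ} (hρ : 0 ≤ ρ) :
    ∃ y : ℂ, ‖y‖ = ρ ∧ ‖b + d * y‖ = ‖b‖ + ‖d‖ * ρ := by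
  refine ⟨ρ * Complex.exp ((b.arg - d.arg : ℝ) * Complex.I), ?_, ?_⟩
  · rw [norm_mul, Complex.norm_exp_ofReal_mul_I, Complex.norm_real, Real.norm_of_nonneg hρ, mul_one]
  · have key : b + d * (ρ * Complex.exp ((b.arg - d.arg : ℝ) * Complex.I)) =
        ((‖b‖ + ‖d‖ * ρ : ℝ) : ℂ) * Complex.exp (b.arg * Complex.I) := by
      have hexp : Complex.exp (b.arg * Complex.I) =
          Complex.exp (d.arg * Complex.I) * Complex.exp ((b.arg - d.arg : ℝ) * Complex.I) := by
        rw [← Complex.exp_add]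
        congr 1
        push_cast
        ring
      have hb := Complex.norm_mul_exp_arg_mul_I b
      have hd := Complex.norm_mul_exp_arg_mul_I d
      generalize Complex.exp ((b.arg - d.arg : ℝ) * Complex.I) = t at *
      push_cast
      linear_combination -hb - ρ * t * hd - (‖d‖ : ℂ) * ρ * hexp
    rw [key, norm_mul, Complex.norm_exp_ofReal_mul_I, mul_one, Complex.norm_real,
      Real.norm_of_nonneg (by positivity)]

/-- If `x (b + d y) / (a + c y)` stays in the punctured disc, then the coefficients satisfy the
inequality obtained by aligning the phases of `b` and `d y` at `‖y‖ = r`. -/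
lemma norm_add_norm_mul_le {r : ℝ} (hr : 0 < r) (hr1 : r ≤ 1) {a b c d : ℂ}
    (H : ∀ x ∈ puncturedDisc r, ∀ y ∈ puncturedDisc r,
      a + c * y ≠ 0 ∧ x * (b + d * y) / (a + c * y) ∈ puncturedDisc r) :
    ‖b‖ + ‖d‖ * r ≤ ‖a‖ + ‖c‖ * r := by
  have hIco : Set.Ico 0 r ⊆ {ρ : ℝ | ‖b‖ + ‖d‖ * ρ ≤ ‖a‖ + ‖c‖ * ρ} := by
    rintro ρ ⟨hρ0, hρr⟩
    obtain ⟨y, hy, hby⟩ := exists_norm_add_mul_eq b d hρ0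
    obtain ⟨hne, hmem⟩ := H r (ofReal_mem_puncturedDisc hr) y
      (mem_puncturedDisc_of_norm_lt_one (by linarith) (by linarith))
    have hle : ‖(r : ℂ) * (b + d * y) / (a + c * y)‖ ≤ r := hmem.1
    rw [norm_div, norm_mul, Complex.norm_real, Real.norm_of_nonneg hr.le,
      div_le_iff₀ (norm_pos_iff.2 hne), mul_le_mul_iff_right₀ hr, hby] at hle
    have htri := norm_add_le a (c * y)
    rw [norm_mul, hy] at htri
    exact hle.trans htri
  have hclosed : IsClosed {ρ : ℝ | ‖b‖ + ‖d‖ * ρ ≤ ‖a‖ + ‖c‖ * ρ} :=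
    isClosed_le (by fun_prop) (by fun_prop)
  have hsub := closure_minimal hIco hclosed
  rw [closure_Ico hr.ne] at hsub
  exact hsub ⟨hr.le, le_rfl⟩

lemma norm_le_of_ratio_mem {r : ℝ} (hr : 0 < r) {a b c d : ℂ}
    (H : ∀ x ∈ puncturedDisc r, ∀ y ∈ puncturedDisc r,
      a + c * y ≠ 0 ∧ x * (b + d * y) / (a + c * y) ∈ puncturedDisc r) :
    a ≠ 0 ∧ ‖b‖ ≤ ‖a‖ := by
  obtain ⟨hne, hmem⟩ := H r (ofReal_mem_puncturedDisc hr) 0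
    (mem_puncturedDisc_of_norm_lt_one (by simpa using hr.le) (by simp))
  simp only [mul_zero, add_zero] at hne hmem
  have hle : ‖(r : ℂ) * b / a‖ ≤ r := hmem.1
  rw [norm_div, norm_mul, Complex.norm_real, Real.norm_of_nonneg hr.le,
    div_le_iff₀ (norm_pos_iff.2 hne), mul_le_mul_iff_right₀ hr] at hle
  exact ⟨hne, hle⟩

lemma edge_coefficient_inequality {r g m k N D : ℝ} (hr : 0 < r) (hg : 0 < g)
    (hgr : g * (1 - r) ≤ r) (hm : m ≤ N) (hk : k ≤ N)
    (hDm : m + D ≤ N + k * r) (hDk : k + D ≤ N + m * r) :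
    m + g * D + r * k ≤ N * (1 + r * (1 + g)) := by
  rcases le_or_gt g 1 with h | h
  · nlinarith [mul_nonneg hg.le (sub_nonneg.2 hDm),
      mul_nonneg (sub_nonneg.2 h) (sub_nonneg.2 hm),
      mul_nonneg (by positivity : 0 ≤ r + g * r) (sub_nonneg.2 hk)]
  · have e1 := mul_nonneg (by positivity : 0 ≤ 1 + g * r) (sub_nonneg.2 hDm)
    have e2 := mul_nonneg (sub_nonneg.2 h.le) (sub_nonneg.2 hDk)
    have e3 := mul_nonneg (mul_nonneg (by positivity : 0 ≤ 1 + r)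
      (by linarith : 0 ≤ 1 + r - g * (1 - r))) (sub_nonneg.2 hk)
    refine le_of_mul_le_mul_left ?_ (by positivity : 0 < 1 + r)
    linarith

/-- Adding an edge between two distinct vertices preserves the ratio region, expressed through
the four coefficients of the partition function in the two fields at the ends of the edge. -/
lemma ratio_mem_of_add_edge {β γ r : ℝ} (hγ : γ < 0) (h1 : 1 ≤ β + γ) (hr : 0 < r) (hr1 : r ≤ 1)
    (hβ : β = 1 + r * (1 - γ)) {a b c d : ℂ}
    (Hu : ∀ x ∈ puncturedDisc r, ∀ y ∈ puncturedDisc r,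
      a + c * y ≠ 0 ∧ x * (b + d * y) / (a + c * y) ∈ puncturedDisc r)
    (Hw : ∀ x ∈ puncturedDisc r, ∀ y ∈ puncturedDisc r,
      a + b * y ≠ 0 ∧ x * (c + d * y) / (a + b * y) ∈ puncturedDisc r)
    {x y : ℂ} (hx : x ∈ puncturedDisc r) (hy : y ∈ puncturedDisc r) :
    β * a + c * y ≠ 0 ∧ x * (b + γ * d * y) / (β * a + c * y) ∈ puncturedDisc r := by
  obtain ⟨ha, hba⟩ := norm_le_of_ratio_mem hr Hu
  obtain ⟨-, hca⟩ := norm_le_of_ratio_mem hr Hw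
  have hDm := norm_add_norm_mul_le hr hr1 Hu
  have hDk := norm_add_norm_mul_le hr hr1 Hw
  have hN : 0 < ‖a‖ := norm_pos_iff.2 ha
  have hxr : ‖x‖ ≤ r := hx.1
  have hyr : ‖y‖ ≤ r := hy.1
  have hβ0 : 0 < β := by nlinarith
  have hcoef := edge_coefficient_inequality hr (neg_pos.2 hγ) (by nlinarith) hba hca hDm hDk
  have hcy : ‖c * y‖ ≤ r * ‖c‖ := by
    rw [norm_mul, mul_comm]
    gcongr
  have hden : β * ‖a‖ - ‖c * y‖ ≤ ‖β * a + c * y‖ := by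
    have := norm_sub_le (β * a + c * y) (c * y)
    rw [add_sub_cancel_right, norm_mul, Complex.norm_real, Real.norm_of_nonneg hβ0.le] at this
    linarith
  have hnum : ‖b + γ * d * y‖ ≤ ‖b‖ + -γ * (‖d‖ * r) := by
    refine (norm_add_le _ _).trans ?_
    rw [norm_mul, norm_mul, Complex.norm_real, Real.norm_of_nonpos hγ.le, mul_assoc]
    have hγ' : 0 ≤ -γ := by linarith
    gcongr
  have hpos : 0 < ‖β * a + c * y‖ := by
    nlinarith [mul_le_mul_of_nonneg_left hca hr.le, mul_pos (mul_pos hr (neg_pos.2 hγ)) hN]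
  have hle : ‖b + γ * d * y‖ ≤ ‖β * a + c * y‖ := by
    have : ‖a‖ * (1 + r * (1 + -γ)) = β * ‖a‖ := by rw [hβ]; ring
    linarith
  refine ⟨norm_pos_iff.1 hpos, ?_⟩
  have hratio : ‖x * (b + γ * d * y) / (β * a + c * y)‖ ≤ r := by
    rw [norm_div, norm_mul, div_le_iff₀ hpos]
    gcongr
  rcases hr1.lt_or_eq with hlt | rfl
  · exact mem_puncturedDisc_of_norm_lt_one hratio (hratio.trans_lt hlt)
  refine mem_puncturedDisc_of_norm_lt_one hratio ?_
  obtain ⟨-, hs⟩ := Hw y hy 0 (mem_puncturedDisc_of_norm_lt_one (by simp) (by simp))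
  simp only [mul_zero, add_zero] at hs
  have hs1 : ‖y * c / a‖ ≤ 1 := hs.1
  have hsre : -1 < (y * c / a).re := by
    refine lt_of_le_of_ne ((abs_le.1 ((Complex.abs_re_le_norm _).trans hs1)).1) fun h => hs.2 ?_
    have hsq := Complex.sq_norm (y * c / a)
    rw [Complex.normSq_apply, ← h] at hsq
    have him : (y * c / a).im = 0 := by
      nlinarith [norm_nonneg (y * c / a), sq_nonneg (y * c / a).im]
    exact Complex.ext (by simp [← h]) (by simp [him])
  have hfac : β * a + c * y = a * (β + y * c / a) := by
    field_simp
  have hstrict : ‖a‖ * (β - 1) < ‖β * a + c * y‖ := by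
    rw [hfac, norm_mul]
    refine mul_lt_mul_of_pos_left ?_ hN
    have := Complex.re_le_norm (β + y * c / a)
    rw [Complex.add_re, Complex.ofReal_re] at this
    linarith
  rw [norm_div, norm_mul, div_lt_one hpos]
  refine lt_of_le_of_lt ?_ hstrict
  have hd : ‖d‖ ≤ ‖a‖ := by linarith
  nlinarith [mul_le_mul_of_nonneg_left hd (neg_pos.2 hγ).le,
    mul_le_mul_of_nonneg_right hxr (norm_nonneg (b + γ * d * y))]

/-- The partition function of an arbitrary configuration weight `f`. -/
noncomputable def spinSum {n : ℕ} (f : (Fin n → Bool) → ℂ) (lam : Fin n → ℂ) : ℂ :=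
  ∑ σ : Fin n → Bool, f σ * ∏ v, (if σ v then lam v else 1)

/-- The part of `spinSum` with spin `i` at `v`. -/
noncomputable def pinnedSum {n : ℕ} (f : (Fin n → Bool) → ℂ) (lam : Fin n → ℂ) (v : Fin n)
    (i : Bool) : ℂ :=
  ∑ σ : Fin n → Bool, if σ v = i then f σ * ∏ u, (if σ u then lam u else 1) else 0

/-- The coefficient of `spinSum` with spins `i` at `u` and `j` at `w`, with the fields at `u`
and `w` removed. -/
noncomputable def pairCoeff {n : ℕ} (f : (Fin n → Bool) → ℂ) (lam : Fin n → ℂ) (u w : Fin n)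
    (i j : Bool) : ℂ :=
  ∑ σ : Fin n → Bool, if σ u = i ∧ σ w = j then
    f σ * ∏ x with x ≠ u ∧ x ≠ w, (if σ x then lam x else 1) else 0

/-- The pinned sum at `v` with spin `0` is nonzero and the ratio at `v` lies in the region. -/
def RatioIn {n : ℕ} (r : ℝ) (f : (Fin n → Bool) → ℂ) (lam : Fin n → ℂ) (v : Fin n) : Prop :=
  pinnedSum f lam v false ≠ 0 ∧
    pinnedSum f lam v true / pinnedSum f lam v false ∈ puncturedDisc r

section

variable {n : ℕ} (f : (Fin n → Bool) → ℂ) (lam : Fin n → ℂ)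

lemma spinSum_eq_pinnedSum_add (v : Fin n) :
    spinSum f lam = pinnedSum f lam v false + pinnedSum f lam v true := by
  unfold spinSum pinnedSum
  rw [← sum_add_distrib]
  refine sum_congr rfl fun σ _ => ?_
  cases σ v <;> simp

lemma pairCoeff_swap (u w : Fin n) (i j : Bool) :
    pairCoeff f lam u w i j = pairCoeff f lam w u j i := by
  unfold pairCoeff
  simp only [and_comm]

lemma pairCoeff_congr {lam' : Fin n → ℂ} {u w : Fin n}
    (h : ∀ x, x ≠ u → x ≠ w → lam' x = lam x) (i j : Bool) :
    pairCoeff f lam' u w i j = pairCoeff f lam u w i j := by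
  unfold pairCoeff
  refine sum_congr rfl fun σ _ => ?_
  congr 2
  refine prod_congr rfl fun x hx => ?_
  rw [mem_filter] at hx
  rw [h x hx.2.1 hx.2.2]

lemma pairCoeff_edge (A : Bool → Bool → ℂ) (u w : Fin n) (i j : Bool) :
    pairCoeff (fun σ => A (σ u) (σ w) * f σ) lam u w i j = A i j * pairCoeff f lam u w i j := by
  unfold pairCoeff
  rw [mul_sum]
  refine sum_congr rfl fun σ _ => ?_
  split_ifs with h
  · simp only [h.1, h.2, mul_assoc]
  · simp

lemma pinnedSum_eq_pairCoeff {u w : Fin n} (huw : u ≠ w) (i : Bool) :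
    pinnedSum f lam u i = (if i then lam u else 1) *
      (pairCoeff f lam u w i false + pairCoeff f lam u w i true * lam w) := by
  unfold pinnedSum pairCoeff
  rw [sum_mul, ← sum_add_distrib, mul_sum]
  refine sum_congr rfl fun σ _ => ?_
  have hprod : ∏ x, (if σ x then lam x else 1) =
      (if σ u then lam u else 1) * ((if σ w then lam w else 1) *
        ∏ x with x ≠ u ∧ x ≠ w, (if σ x then lam x else 1)) := by
    have hset : (univ.filter fun x : Fin n => x ≠ u ∧ x ≠ w) = (univ.erase u).erase w := by
      ext x
      simp [and_comm]
    rw [hset, mul_prod_erase _ (fun x => if σ x then lam x else 1) (by simp [huw.symm]),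
      mul_prod_erase _ (fun x => if σ x then lam x else 1) (mem_univ u)]
  rw [hprod]
  by_cases hi : σ u = i
  · subst hi
    cases σ w <;> simp <;> ring_nf
  · simp [hi]

lemma pinnedSum_loop (A : Bool → Bool → ℂ) (v : Fin n) (i : Bool) :
    pinnedSum (fun σ => A (σ v) (σ v) * f σ) lam v i = A i i * pinnedSum f lam v i := by
  unfold pinnedSum
  rw [mul_sum]
  refine sum_congr rfl fun σ _ => ?_
  split_ifs with h
  · simp only [h, mul_assoc]
  · simp

lemma pinnedSum_false_eq_spinSum (v : Fin n) :
    pinnedSum f lam v false = spinSum f (Function.update lam v 0) := by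
  unfold pinnedSum spinSum
  refine sum_congr rfl fun σ _ => ?_
  split_ifs with h
  · congr 1
    refine prod_congr rfl fun x _ => ?_
    by_cases hx : x = v
    · subst hx
      simp [h]
    · rw [Function.update_of_ne hx]
  · rw [prod_eq_zero (mem_univ v) (by simpa using h), mul_zero]

lemma pinnedSum_true_of_isolated {v : Fin n} (hf : ∀ σ i, f (Function.update σ v i) = f σ) :
    pinnedSum f lam v true = lam v * pinnedSum f lam v false := by
  have hinv : Function.Involutive fun σ : Fin n → Bool => Function.update σ v (!σ v) := by
    intro σ
    simp
  unfold pinnedSum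
  rw [mul_sum, ← Equiv.sum_comp (hinv.toPerm _)]
  refine sum_congr rfl fun σ _ => ?_
  have hs : hinv.toPerm _ σ = Function.update σ v (!σ v) := rfl
  rw [hs, hf, Function.update_self]
  cases h : σ v
  · have hprod : ∀ τ : Fin n → Bool, ∏ x, (if τ x then lam x else 1) =
        (if τ v then lam v else 1) * ∏ x ∈ univ.erase v, (if τ x then lam x else 1) :=
      fun τ => (mul_prod_erase _ (fun x => if τ x then lam x else 1) (mem_univ v)).symm
    have hrest : ∏ x ∈ univ.erase v, (if Function.update σ v true x then lam x else 1) =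
        ∏ x ∈ univ.erase v, (if σ x then lam x else 1) :=
      prod_congr rfl fun x hx => by rw [Function.update_of_ne (ne_of_mem_erase hx)]
    rw [Bool.not_false, hprod, hprod σ, hrest]
    simp [h]
    ring
  · simp

lemma spinSum_one : spinSum (fun _ => 1) lam = ∏ v, (1 + lam v) := by
  have h := prod_univ_sum (fun _ : Fin n => (univ : Finset Bool))
    (fun v i => if i then lam v else 1)
  rw [Fintype.piFinset_univ] at h
  unfold spinSum
  simp only [one_mul]
  rw [← h]
  exact prod_congr rfl fun v _ => by simp [add_comm]

variable {f lam}

lemma RatioIn.spinSum_ne_zero {r : ℝ} {v : Fin n} (h : RatioIn r f lam v) : spinSum f lam ≠ 0 := by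
  rw [spinSum_eq_pinnedSum_add f lam v]
  intro h0
  refine h.2.2 ?_
  rw [Set.mem_singleton_iff, div_eq_iff h.1]
  linear_combination h0

lemma ratioIn_of_isolated {r : ℝ} {v : Fin n} (hf : ∀ σ i, f (Function.update σ v i) = f σ)
    (hlam : lam v ∈ puncturedDisc r) (hZ : spinSum f (Function.update lam v 0) ≠ 0) :
    RatioIn r f lam v := by
  rw [← pinnedSum_false_eq_spinSum] at hZ
  refine ⟨hZ, ?_⟩
  rwa [pinnedSum_true_of_isolated f lam hf, mul_div_cancel_right₀ _ hZ]

end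

lemma edgeW_comm (β γ : ℝ) (i j : Bool) : edgeW β γ i j = edgeW β γ j i := by
  cases i <;> cases j <;> rfl

/-- Adding an edge at `v` keeps the ratio at `v` in the region. -/
lemma ratioIn_of_add_edge {β γ r : ℝ} (hγ : γ < 0) (h1 : 1 ≤ β + γ) (hr : 0 < r) (hr1 : r ≤ 1)
    (hβ : β = 1 + r * (1 - γ)) {n : ℕ} {f : (Fin n → Bool) → ℂ}
    (hf : ∀ lam : Fin n → ℂ, (∀ v, lam v ∈ puncturedDisc r) → ∀ v, RatioIn r f lam v)
    {lam : Fin n → ℂ} (hlam : ∀ v, lam v ∈ puncturedDisc r) (v w : Fin n) :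
    RatioIn r (fun σ => edgeW β γ (σ v) (σ w) * f σ) lam v := by
  by_cases hvw : v = w
  · subst hvw
    obtain ⟨hne, hmem⟩ := hf lam hlam v
    have hβ0 : 0 < β := by linarith
    have hβc : (β : ℂ) ≠ 0 := by exact_mod_cast hβ0.ne'
    unfold RatioIn
    rw [pinnedSum_loop, pinnedSum_loop]
    simp only [edgeW, if_true, Bool.false_eq_true, if_false]
    refine ⟨mul_ne_zero hβc hne, ?_⟩
    have hR : ‖pinnedSum f lam v true / pinnedSum f lam v false‖ ≤ r := hmem.1
    have hlt : ‖γ * pinnedSum f lam v true / (β * pinnedSum f lam v false)‖ < r := by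
      rw [mul_div_mul_comm, norm_mul, norm_div, Complex.norm_real, Complex.norm_real,
        Real.norm_of_nonneg hβ0.le, Real.norm_of_nonpos hγ.le]
      have hq : -γ / β < 1 := by
        rw [div_lt_one hβ0]
        linarith
      have hq0 : 0 ≤ -γ / β := div_nonneg (by linarith) hβ0.le
      nlinarith [mul_le_mul_of_nonneg_left hR hq0]
    exact mem_puncturedDisc_of_norm_lt_one hlt.le (hlt.trans_le hr1)
  have hvary : ∀ x ∈ puncturedDisc r, ∀ y ∈ puncturedDisc r, ∃ lam' : Fin n → ℂ,
      (∀ v, lam' v ∈ puncturedDisc r) ∧ lam' v = x ∧ lam' w = y ∧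
        ∀ z, z ≠ v → z ≠ w → lam' z = lam z := by
    intro x hx y hy
    refine ⟨Function.update (Function.update lam v x) w y, fun z => ?_, ?_, ?_, ?_⟩
    · by_cases hzw : z = w
      · subst hzw
        simpa
      · by_cases hzv : z = v
        · subst hzv
          simpa [hzw] using hx
        · simpa [hzw, hzv] using hlam z
    · simp [hvw]
    · simp
    · intro z hzv hzw
      simp [hzv, hzw]
  have Hu : ∀ x ∈ puncturedDisc r, ∀ y ∈ puncturedDisc r,
      pairCoeff f lam v w false false + pairCoeff f lam v w false true * y ≠ 0 ∧
      x * (pairCoeff f lam v w true false + pairCoeff f lam v w true true * y) /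
        (pairCoeff f lam v w false false + pairCoeff f lam v w false true * y) ∈
          puncturedDisc r := by
    intro x hx y hy
    obtain ⟨lam', hl, hv, hw, hrest⟩ := hvary x hx y hy
    have h := hf lam' hl v
    unfold RatioIn at h
    rw [pinnedSum_eq_pairCoeff f lam' hvw, pinnedSum_eq_pairCoeff f lam' hvw, hv, hw] at h
    simpa [pairCoeff_congr f lam hrest] using h
  have Hw : ∀ y ∈ puncturedDisc r, ∀ x ∈ puncturedDisc r,
      pairCoeff f lam v w false false + pairCoeff f lam v w true false * x ≠ 0 ∧
      y * (pairCoeff f lam v w false true + pairCoeff f lam v w true true * x) /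
        (pairCoeff f lam v w false false + pairCoeff f lam v w true false * x) ∈
          puncturedDisc r := by
    intro y hy x hx
    obtain ⟨lam', hl, hv, hw, hrest⟩ := hvary x hx y hy
    have h := hf lam' hl w
    unfold RatioIn at h
    rw [pinnedSum_eq_pairCoeff f lam' (Ne.symm hvw), pinnedSum_eq_pairCoeff f lam' (Ne.symm hvw),
      hv, hw] at h
    simpa [pairCoeff_swap f lam' w v, pairCoeff_congr f lam hrest] using h
  have key := ratio_mem_of_add_edge hγ h1 hr hr1 hβ Hu Hw (hlam v) (hlam w)
  unfold RatioIn
  rw [pinnedSum_eq_pairCoeff _ lam hvw, pinnedSum_eq_pairCoeff _ lam hvw]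
  simp only [pairCoeff_edge]
  simpa [edgeW] using key

/-- The product of the edge interactions of a configuration. -/
noncomputable def edgeWeight (β γ : ℝ) {n : ℕ} (E : Multiset (Fin n × Fin n))
    (σ : Fin n → Bool) : ℂ :=
  (E.map fun e => edgeW β γ (σ e.1) (σ e.2)).prod

theorem ratioIn_and_spinSum_ne_zero {β γ r : ℝ} (hγ : γ < 0) (h1 : 1 ≤ β + γ) (hr : 0 < r)
    (hr1 : r ≤ 1) (hβ : β = 1 + r * (1 - γ)) {n : ℕ} (E : Multiset (Fin n × Fin n)) :
    ∀ lam : Fin n → ℂ, (∀ v, lam v ∈ puncturedDisc r) →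
      (∀ v, RatioIn r (edgeWeight β γ E) lam v) ∧ spinSum (edgeWeight β γ E) lam ≠ 0 := by
  induction E using Multiset.strongInductionOn with
  | ih E ih =>
  have hincident : ∀ lam : Fin n → ℂ, (∀ v, lam v ∈ puncturedDisc r) → ∀ e ∈ E, ∀ v,
      e.1 = v ∨ e.2 = v → RatioIn r (edgeWeight β γ E) lam v := by
    intro lam hlam e he v hv
    obtain ⟨E', rfl⟩ := Multiset.exists_cons_of_mem he
    have hE' := fun lam hlam => (ih E' (Multiset.lt_cons_self E' e) lam hlam).1
    have hcons : edgeWeight β γ (e ::ₘ E') =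
        fun σ => edgeW β γ (σ e.1) (σ e.2) * edgeWeight β γ E' σ := by
      funext σ
      simp [edgeWeight]
    rw [hcons]
    rcases hv with rfl | rfl
    · exact ratioIn_of_add_edge hγ h1 hr hr1 hβ hE' hlam e.1 e.2
    · have h := ratioIn_of_add_edge hγ h1 hr hr1 hβ hE' hlam e.2 e.1
      have hcomm : ∀ σ : Fin n → Bool,
          edgeW β γ (σ e.1) (σ e.2) = edgeW β γ (σ e.2) (σ e.1) := fun σ => edgeW_comm β γ _ _
      simpa only [hcomm] using h
  have hZ : ∀ lam : Fin n → ℂ, (∀ v, lam v ∈ puncturedDisc r) →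
      spinSum (edgeWeight β γ E) lam ≠ 0 := by
    intro lam hlam
    rcases E.empty_or_exists_mem with rfl | ⟨e, he⟩
    · have hone : edgeWeight β γ (0 : Multiset (Fin n × Fin n)) = fun _ => 1 := by
        funext σ
        simp [edgeWeight]
      rw [hone, spinSum_one, prod_ne_zero_iff]
      exact fun v _ h0 => (hlam v).2 (eq_neg_of_add_eq_zero_right h0)
    · exact (hincident lam hlam e he e.1 (Or.inl rfl)).spinSum_ne_zero
  intro lam hlam
  refine ⟨fun v => ?_, hZ lam hlam⟩
  by_cases hv : ∃ e ∈ E, e.1 = v ∨ e.2 = v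
  · obtain ⟨e, he, hev⟩ := hv
    exact hincident lam hlam e he v hev
  · push Not at hv
    refine ratioIn_of_isolated (fun σ i => ?_) (hlam v) (hZ _ fun x => ?_)
    · unfold edgeWeight
      congr 1
      refine Multiset.map_congr rfl fun e he => ?_
      rw [Function.update_of_ne (hv e he).1, Function.update_of_ne (hv e he).2]
    · by_cases hx : x = v
      · subst hx
        simpa using mem_puncturedDisc_of_norm_lt_one (z := 0) (by simpa using hr.le) (by simp)
      · simpa [hx] using hlam x

/-- For `γ < 0` and `1 ≤ β + γ ≤ 2`, with `r = (β-1)/(1-γ)` and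
`K = {z : |z| ≤ r} \ {-1}`: for every graph `G`, every external field in
`K^{V(G)}` and every vertex `v`, (1) `[Z_{G,v}(λ)]₀ ≠ 0` and the ratio
`R_{G,v}(λ)` lies in `K`, and (2) `Z_G(λ) ≠ 0`. -/
theorem stmt3 (β γ : ℝ) (hγ : γ < 0) (h1 : 1 ≤ β + γ) (h2 : β + γ ≤ 2)
    (r : ℝ) (hr : r = (β - 1) / (1 - γ))
    (K : Set ℂ) (hK : K = {z : ℂ | ‖z‖ ≤ r} \ {-1})
    (G : MultiGraph) (lam : Fin G.n → ℂ) (hlam : ∀ v, lam v ∈ K) :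
    (∀ v : Fin G.n,
        ZCv β γ G lam v false ≠ 0 ∧
        ZCv β γ G lam v true / ZCv β γ G lam v false ∈ K) ∧
    ZC β γ G lam ≠ 0 := by
  have hγ1 : 0 < 1 - γ := by linarith
  have hr0 : 0 < r := by
    rw [hr]
    exact div_pos (by linarith) hγ1
  have hr1 : r ≤ 1 := by
    rw [hr, div_le_one hγ1]
    linarith
  have hβ : β = 1 + r * (1 - γ) := by
    rw [hr, div_mul_cancel₀ _ hγ1.ne']
    ring
  subst hK
  exact ratioIn_and_spinSum_ne_zero hγ h1 hr0 hr1 hβ G.edges lam hlam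
end

section
/- Let β and γ be real numbers with γ < 0 and 1 ≤ β + γ ≤ 2. For every real r > (β−1)/(1−γ) there exists a graph G such that the polynomial Z_G(x) has a root in the open disk {z ∈ ℂ : |z| < r}. In fact, for the star graph G_n with vertices v₀, v₁, …, v_n and edges {v₀,v₁}, …, {v₀,v_n}, one has Z_{G_n}(x) = (β + x)^n + x(1 + γx)^n, and for every r with (β−1)/(1−γ) < r < β and all sufficiently large n, Z_{G_n}(x) has a real root in the interval (−r, 0). -/
open scoped BigOperators

/-- The star graph `G_n` : vertices `v₀, v₁, …, v_n` and edges `{v₀,v₁}, …, {v₀,v_n}`. -/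
def starGraph (n : ℕ) : MultiGraph :=
  ⟨n + 1, (Finset.univ.val : Multiset (Fin n)).map (fun i => ((0 : Fin (n + 1)), i.succ))⟩

/-- The partition function of the star graph: condition on the spin of the centre, after which
the leaves decouple. -/
theorem ZC_starGraph (β γ : ℝ) (n : ℕ) (x : ℂ) :
    ZC β γ (starGraph n) (fun _ => x) = (β + x) ^ n + x * (1 + γ * x) ^ n := by
  have leaves (b : Bool) :
      ∑ τ : Fin n → Bool, ∏ i, edgeW β γ b (τ i) * (if τ i then x else 1) =
        (edgeW β γ b true * x + edgeW β γ b false) ^ n := by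
    rw [← Fintype.sum_pow (fun c : Bool => edgeW β γ b c * (if c then x else 1)) n]
    simp
  have centre : ZC β γ (starGraph n) (fun _ => x) =
      ∑ p : Bool × (Fin n → Bool),
        (∏ i, edgeW β γ p.1 (p.2 i)) * ((if p.1 then x else 1) * ∏ i, if p.2 i then x else 1) := by
    refine (Fintype.sum_equiv (Fin.consEquiv fun _ : Fin (n + 1) => Bool) _ _ fun p => ?_).symm
    simp only [starGraph, Multiset.map_map, Function.comp_def, Fin.consEquiv_apply, Fin.cons_zero,
      Fin.cons_succ]
    exact congrArg ((∏ i, edgeW β γ p.1 (p.2 i)) * ·) (Fin.prod_univ_succ fun v : Fin (n + 1) =>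
      if (Fin.cons p.1 p.2 : Fin (n + 1) → Bool) v then x else 1).symm
  have split (b : Bool) :
      ∑ τ : Fin n → Bool,
        (∏ i, edgeW β γ b (τ i)) * ((if b then x else 1) * ∏ i, if τ i then x else 1) =
      (if b then x else 1) * (edgeW β γ b true * x + edgeW β γ b false) ^ n := by
    rw [← leaves, Finset.mul_sum]
    refine Finset.sum_congr rfl fun τ _ => ?_
    rw [Finset.prod_mul_distrib]
    ring
  rw [centre, Fintype.sum_prod_type]
  simp only [split, Fintype.sum_bool]
  simp [edgeW]
  ring

/-- If `1 < β` and `γ < 0`, the polynomial `(β + x) ^ n + x * (1 + γ * x) ^ n` eventually has a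
real root in `(-r, 0)`, for each `r` with `(β - 1) / (1 - γ) < r < β`. -/
theorem exists_root_star_polynomial {β γ r : ℝ} (hβ : 1 < β) (hγ : γ < 0)
    (hr : (β - 1) / (1 - γ) < r) (hrβ : r < β) :
    ∃ N : ℕ, ∀ n ≥ N, ∃ x : ℝ, -r < x ∧ x < 0 ∧ (β + x) ^ n + x * (1 + γ * x) ^ n = 0 := by
  have hr0 : 0 < r := lt_trans (div_pos (by linarith) (by linarith)) hr
  have hlt : β - r < 1 - γ * r := by
    rw [div_lt_iff₀ (by linarith)] at hr
    linarith
  have hpos : 0 < 1 - γ * r := by nlinarith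
  have hq0 : 0 ≤ (β - r) / (1 - γ * r) := div_nonneg (by linarith) hpos.le
  have hq1 : (β - r) / (1 - γ * r) < 1 := (div_lt_one hpos).2 hlt
  obtain ⟨N, hN⟩ := exists_pow_lt_of_lt_one hr0 hq1
  refine ⟨N, fun n hn => ?_⟩
  have hneg : (β + -r) ^ n + -r * (1 + γ * -r) ^ n < 0 := by
    have h := (pow_le_pow_of_le_one hq0 hq1.le hn).trans_lt hN
    rw [div_pow, div_lt_iff₀ (pow_pos hpos n)] at h
    simp only [mul_neg, ← sub_eq_add_neg, neg_mul]
    linarith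
  have hβn : 0 < (β + 0) ^ n + 0 * (1 + γ * 0) ^ n := by
    have := pow_pos (zero_lt_one.trans hβ) n
    simpa
  obtain ⟨x, hx, hx0⟩ := intermediate_value_Ioo (neg_nonpos.2 hr0.le)
    (f := fun x : ℝ => (β + x) ^ n + x * (1 + γ * x) ^ n)
    (Continuous.continuousOn (by fun_prop)) ⟨hneg, hβn⟩
  exact ⟨x, hx.1, hx.2, hx0⟩

/-- For `γ < 0` and `1 ≤ β + γ ≤ 2`: for every `r > (β-1)/(1-γ)` there is a graph `G`
whose partition-function polynomial has a root in the open disk of radius `r`;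
moreover, the star graph `G_n` has `Z_{G_n}(x) = (β+x)^n + x(1+γx)^n`, and for every
`(β-1)/(1-γ) < r < β` and all sufficiently large `n`, `Z_{G_n}(x)` has a real root
in `(-r, 0)`. -/
theorem stmt4 (β γ : ℝ) (hγ : γ < 0) (h1 : 1 ≤ β + γ) (h2 : β + γ ≤ 2) :
    (∀ r : ℝ, (β - 1) / (1 - γ) < r →
      ∃ (G : MultiGraph) (z : ℂ), ‖z‖ < r ∧ ZC β γ G (fun _ => z) = 0) ∧
    (∀ (n : ℕ) (x : ℂ),
      ZC β γ (starGraph n) (fun _ => x) = (β + x) ^ n + x * (1 + γ * x) ^ n) ∧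
    (∀ r : ℝ, (β - 1) / (1 - γ) < r → r < β →
      ∃ N : ℕ, ∀ n ≥ N,
        ∃ x : ℝ, -r < x ∧ x < 0 ∧ ZC β γ (starGraph n) (fun _ => (x : ℂ)) = 0) := by
  have hβ : 1 < β := by linarith
  have star (r : ℝ) (hr : (β - 1) / (1 - γ) < r) (hrβ : r < β) : ∃ N : ℕ, ∀ n ≥ N,
      ∃ x : ℝ, -r < x ∧ x < 0 ∧ ZC β γ (starGraph n) (fun _ => (x : ℂ)) = 0 := by
    obtain ⟨N, hN⟩ := exists_root_star_polynomial hβ hγ hr hrβ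
    refine ⟨N, fun n hn => ?_⟩
    obtain ⟨x, hxr, hx0, hx⟩ := hN n hn
    exact ⟨x, hxr, hx0, by rw [ZC_starGraph]; exact_mod_cast hx⟩
  refine ⟨fun r hr => ?_, ZC_starGraph β γ, star⟩
  have hβr : (β - 1) / (1 - γ) < β := by
    rw [div_lt_iff₀ (by linarith)]
    nlinarith
  obtain ⟨s, hs, hsr⟩ := exists_between (lt_min hr hβr)
  obtain ⟨N, hN⟩ := star s hs (hsr.trans_le (min_le_right _ _))
  obtain ⟨x, hxs, hx0, hx⟩ := hN N le_rfl
  refine ⟨starGraph N, x, ?_, hx⟩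
  rw [Complex.norm_real, Real.norm_eq_abs, abs_of_neg hx0]
  linarith [hsr.trans_le (min_le_left _ _)]
end

section
/- Let β and γ be real numbers with β > γ and β + γ > 2. Then there exists a real number r > 1 such that the polynomial γ·z₁·z₂ + z₁ + z₂ + β is nonzero for all complex z₁, z₂ with |z₁| < r and |z₂| < r. -/
/-- If the two endpoint conditions hold at radius `r`, then `|γ z + 1| r < |z + β|`
on the open disc of radius `r`, in squared form. -/
lemma sq_mul_normSq_lt_normSq_add {β γ r : ℝ} (hr : 0 < r) (hβ : r < β)
    (hdiff : 0 < β - r ^ 2 * γ) (hsum : 0 < β - 2 * r + r ^ 2 * γ)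
    {z : ℂ} (hz : ‖z‖ < r) :
    r ^ 2 * Complex.normSq (γ * z + 1) < Complex.normSq (z + β) := by
  have hs : 0 ≤ ‖z‖ := norm_nonneg z
  have hre : -‖z‖ ≤ z.re := (abs_le.mp (Complex.abs_re_le_norm z)).1
  have hsq : ‖z‖ ^ 2 = z.re * z.re + z.im * z.im := by
    rw [← Complex.normSq_eq_norm_sq, Complex.normSq_apply]
  have hfst : 0 < β - ‖z‖ - r + r * γ * ‖z‖ := by
    have : 0 < r * (β - ‖z‖ - r + r * γ * ‖z‖) := by
      nlinarith [mul_pos (sub_pos.mpr hz) (sub_pos.mpr hβ), mul_nonneg hs hsum.le]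
    exact pos_of_mul_pos_right this hr.le
  have hsnd : 0 < β - ‖z‖ + r - r * γ * ‖z‖ := by
    have : 0 < r * (β - ‖z‖ + r - r * γ * ‖z‖) := by
      nlinarith [mul_pos (sub_pos.mpr hz) (by linarith : 0 < β + r), mul_nonneg hs hdiff.le]
    exact pos_of_mul_pos_right this hr.le
  have hexpand : Complex.normSq (z + β) - r ^ 2 * Complex.normSq (γ * z + 1) =
      (β - ‖z‖ - r + r * γ * ‖z‖) * (β - ‖z‖ + r - r * γ * ‖z‖)
        + 2 * ((β - r ^ 2 * γ) * (z.re + ‖z‖)) := by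
    simp only [Complex.normSq_apply, Complex.add_re, Complex.add_im, Complex.mul_re,
      Complex.mul_im, Complex.ofReal_re, Complex.ofReal_im, Complex.one_re, Complex.one_im]
    linear_combination (r ^ 2 * γ ^ 2 - 1) * hsq
  have hprod := mul_pos hfst hsnd
  have hnonneg := mul_nonneg hdiff.le (by linarith : 0 ≤ z.re + ‖z‖)
  linarith

/-- For real `β > γ` with `β + γ > 2`, there is `r > 1` such that
`γ·z₁·z₂ + z₁ + z₂ + β ≠ 0` whenever `|z₁| < r` and `|z₂| < r`. -/
theorem stmt5 (β γ : ℝ) (h1 : β > γ) (h2 : β + γ > 2) :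
    ∃ r : ℝ, 1 < r ∧ ∀ z₁ z₂ : ℂ, ‖z₁‖ < r → ‖z₂‖ < r →
      (γ : ℂ) * z₁ * z₂ + z₁ + z₂ + (β : ℂ) ≠ 0 := by
  have hβ : ∀ᶠ r : ℝ in nhds 1, r < β := eventually_lt_nhds (by linarith)
  have hdiff : ∀ᶠ r : ℝ in nhds 1, 0 < β - r ^ 2 * γ :=
    ContinuousAt.eventually_lt (by fun_prop) (by fun_prop) (by linarith)
  have hsum : ∀ᶠ r : ℝ in nhds 1, 0 < β - 2 * r + r ^ 2 * γ :=
    ContinuousAt.eventually_lt (by fun_prop) (by fun_prop) (by linarith)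
  obtain ⟨r, ⟨hrβ, hrdiff, hrsum⟩, hr⟩ :=
    ((((hβ.and (hdiff.and hsum)).filter_mono nhdsWithin_le_nhds).and
      (self_mem_nhdsWithin : Set.Ioi (1 : ℝ) ∈ nhdsWithin 1 (Set.Ioi 1)))).exists
  have hr1 : 1 < r := hr
  refine ⟨r, hr1, fun z₁ z₂ hz₁ hz₂ h0 => ?_⟩
  have hlt := sq_mul_normSq_lt_normSq_add (by linarith) hrβ hrdiff hrsum hz₁
  have heq : z₁ + β = -(z₂ * (γ * z₁ + 1)) := by linear_combination h0
  rw [heq, Complex.normSq_neg, Complex.normSq_mul, Complex.normSq_eq_norm_sq z₂] at hlt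
  have hle : ‖z₂‖ ^ 2 ≤ r ^ 2 := by gcongr
  exact absurd hlt (not_lt.mpr (mul_le_mul_of_nonneg_right hle (Complex.normSq_nonneg _)))
end

section
/- Let β and γ be real numbers with β < γ and β + γ < −2. Then there exists a real number r > 1 such that the polynomial γ·z₁·z₂ + z₁ + z₂ + β is nonzero for all complex z₁, z₂ with |z₁| < r and |z₂| < r. -/
/-- On the closed unit disc, `|γ z + 1| < |z + β|`. -/
lemma normSq_mul_add_one_lt_normSq_add {β γ : ℝ} (h1 : β < γ) (h2 : β + γ < -2) {z : ℂ}
    (hz : ‖z‖ ≤ 1) : Complex.normSq (γ * z + 1) < Complex.normSq (z + β) := by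
  have hre : z.re ≤ ‖z‖ := Complex.re_le_norm z
  have hsq : ‖z‖ ^ 2 = z.re * z.re + z.im * z.im := by
    rw [Complex.sq_norm, Complex.normSq_apply]
  have h0 : 0 ≤ ‖z‖ := norm_nonneg z
  generalize ‖z‖ = ρ at *
  have hminus : β - 1 + (1 - γ) * ρ < 0 := by
    nlinarith [mul_nonneg h0 (sub_nonneg.2 h1.le)]
  have hplus : β + 1 + (1 + γ) * ρ < 0 := by
    nlinarith [mul_nonneg h0 (sub_nonneg.2 h2.le)]
  have hprod := mul_pos_of_neg_of_neg hminus hplus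
  have hx := mul_nonneg (sub_nonneg.2 h1.le) (sub_nonneg.2 hre)
  simp only [Complex.normSq_apply, Complex.add_re, Complex.add_im, Complex.mul_re, Complex.mul_im,
    Complex.ofReal_re, Complex.ofReal_im, Complex.one_re, Complex.one_im]
  linear_combination hprod + 2 * hx + (1 - γ ^ 2) * hsq

/-- The polynomial has no zeros on the closed unit bidisc. -/
lemma bilinear_ne_zero_of_norm_le_one {β γ : ℝ} (h1 : β < γ) (h2 : β + γ < -2) {z₁ z₂ : ℂ}
    (hz₁ : ‖z₁‖ ≤ 1) (hz₂ : ‖z₂‖ ≤ 1) : (γ : ℂ) * z₁ * z₂ + z₁ + z₂ + (β : ℂ) ≠ 0 := by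
  intro h
  have heq : z₁ + β = -(z₂ * (γ * z₁ + 1)) := by linear_combination h
  have hlt := normSq_mul_add_one_lt_normSq_add h1 h2 hz₁
  rw [heq, Complex.normSq_neg, Complex.normSq_mul] at hlt
  have hle : Complex.normSq z₂ ≤ 1 := by
    rw [Complex.normSq_eq_norm_sq]
    exact pow_le_one₀ (norm_nonneg _) hz₂
  exact hlt.not_ge (mul_le_of_le_one_left (Complex.normSq_nonneg _) hle)

/-- A continuous function without zeros on the closed unit ball of a finite-dimensional space has
no zeros on some larger ball. -/
lemma exists_one_lt_forall_norm_lt_ne_zero {E : Type*} [NormedAddCommGroup E] [NormedSpace ℝ E]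
    [ProperSpace E] {f : E → ℂ} (hf : Continuous f)
    (hne : ∀ p ∈ Metric.closedBall (0 : E) 1, f p ≠ 0) :
    ∃ r : ℝ, 1 < r ∧ ∀ p : E, ‖p‖ < r → f p ≠ 0 := by
  obtain ⟨δ, hδ, hthick⟩ := (isCompact_closedBall (0 : E) 1).exists_thickening_subset_open
    (isOpen_ne_fun hf continuous_const) hne
  rw [thickening_closedBall hδ zero_le_one] at hthick
  exact ⟨δ + 1, by linarith, fun p hp => hthick (mem_ball_zero_iff.2 hp)⟩

/-- For real `β < γ` with `β + γ < −2`, there is `r > 1` such that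
`γ·z₁·z₂ + z₁ + z₂ + β ≠ 0` whenever `|z₁| < r` and `|z₂| < r`. -/
theorem stmt6 (β γ : ℝ) (h1 : β < γ) (h2 : β + γ < -2) :
    ∃ r : ℝ, 1 < r ∧ ∀ z₁ z₂ : ℂ, ‖z₁‖ < r → ‖z₂‖ < r →
      (γ : ℂ) * z₁ * z₂ + z₁ + z₂ + (β : ℂ) ≠ 0 := by
  have hcont : Continuous fun p : ℂ × ℂ => (γ : ℂ) * p.1 * p.2 + p.1 + p.2 + (β : ℂ) := by
    fun_prop
  have hsub : ∀ p ∈ Metric.closedBall (0 : ℂ × ℂ) 1,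
      (γ : ℂ) * p.1 * p.2 + p.1 + p.2 + (β : ℂ) ≠ 0 := by
    intro p hp
    have hp' := mem_closedBall_zero_iff.1 hp
    exact bilinear_ne_zero_of_norm_le_one h1 h2 ((norm_fst_le p).trans hp')
      ((norm_snd_le p).trans hp')
  obtain ⟨r, hr, hball⟩ := exists_one_lt_forall_norm_lt_ne_zero hcont hsub
  exact ⟨r, hr, fun z₁ z₂ hz₁ hz₂ => hball (z₁, z₂) (max_lt hz₁ hz₂)⟩
end

section
/- Fix real numbers β and γ, and suppose there is r > 0 such that the polynomial γ·z₁·z₂ + z₁ + z₂ + β is nonzero whenever |z₁| < r and |z₂| < r. Then for every graph G and every external field vector λ : V(G) → ℂ satisfying |λ_v| < r^{deg_G(v)} for all v ∈ V(G), the partition function Z_G(λ) is nonzero. -/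
open scoped BigOperators

/-- The degree of a vertex: the number of edge-endpoints at `v`
(a self-loop at `v` counts twice). -/
def degree (G : MultiGraph) (v : Fin G.n) : ℕ :=
  Multiset.card (G.edges.filter fun e => e.1 = v) +
    Multiset.card (G.edges.filter fun e => e.2 = v)

/-- Asano contraction: if a bi-affine polynomial does not vanish on a bidisc, then its diagonal
part does not vanish on the disc whose radius is the product of the radii. -/
theorem asano_contraction {a b c d : ℂ} {R S : ℝ} (hR : 0 < R) (hS : 0 < S)
    (h : ∀ x y : ℂ, ‖x‖ < R → ‖y‖ < S → a + b * x + c * y + d * x * y ≠ 0)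
    (z : ℂ) (hz : ‖z‖ < R * S) : a + d * z ≠ 0 := by
  intro h0
  have ha : a ≠ 0 := by simpa using h 0 0 (by simpa using hR) (by simpa using hS)
  have hd : d ≠ 0 := by
    rintro rfl
    exact ha (by simpa using h0)
  have hRC : (R : ℂ) ≠ 0 := by exact_mod_cast hR.ne'
  have hSC : (S : ℂ) ≠ 0 := by exact_mod_cast hS.ne'
  have hq : d * R * S ≠ 0 := mul_ne_zero (mul_ne_zero hd hRC) hSC
  -- restrict to the ray `x = R w`, `y = S w`: the two roots have product of modulus below one
  obtain ⟨s, hs⟩ := IsAlgClosed.exists_pow_nat_eq (discrim (d * R * S) (b * R + c * S) a)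
    (n := 2) (by norm_num)
  have hroot : ∀ w : ℂ, d * R * S * (w * w) + (b * R + c * S) * w + a = 0 → 1 ≤ ‖w‖ := by
    intro w hw
    by_contra! hlt
    refine h (R * w) (S * w) ?_ ?_ (by rw [← hw]; ring)
    · rw [norm_mul, Complex.norm_of_nonneg hR.le]
      nlinarith
    · rw [norm_mul, Complex.norm_of_nonneg hS.le]
      nlinarith
  have hdisc : discrim (d * R * S) (b * R + c * S) a = s * s := by rw [← hs, sq]
  have h1 := hroot _ ((quadratic_eq_zero_iff hq hdisc _).mpr (Or.inl rfl))
  have h2 := hroot _ ((quadratic_eq_zero_iff hq hdisc _).mpr (Or.inr rfl))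
  have hprod : (-(b * R + c * S) + s) / (2 * (d * R * S)) *
      ((-(b * R + c * S) - s) / (2 * (d * R * S))) * (R * S) = -z := by
    have ha' : a = -(d * z) := eq_neg_of_add_eq_zero_left h0
    rw [discrim, ha'] at hs
    field_simp
    linear_combination (-1 : ℂ) * hs
  have hnorm := congrArg norm hprod
  rw [norm_mul, norm_mul, norm_neg, norm_mul (R : ℂ), Complex.norm_of_nonneg hR.le,
    Complex.norm_of_nonneg hS.le] at hnorm
  have := one_le_mul_of_one_le_of_one_le h1 h2
  have hRS := mul_pos hR hS
  nlinarith

/-- The monomial of the spin configuration `σ` in the external fields `lam`. -/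
noncomputable def fieldMonomial {V : Type*} [Fintype V] (lam : V → ℂ) (σ : V → Bool) : ℂ :=
  ∏ v, if σ v then lam v else 1

theorem fieldMonomial_update {V : Type*} [Fintype V] [DecidableEq V] (lam : V → ℂ) (u : V)
    (x : ℂ) (σ : V → Bool) :
    fieldMonomial (Function.update lam u x) σ =
      (if σ u then x else 1) * fieldMonomial (Function.update lam u 1) σ := by
  unfold fieldMonomial
  rw [← Finset.mul_prod_erase _ _ (Finset.mem_univ u),
    ← Finset.mul_prod_erase _ (fun v => if σ v then Function.update lam u 1 v else 1)
      (Finset.mem_univ u)]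
  simp only [Function.update_self, ite_self, one_mul]
  congr 1
  refine Finset.prod_congr rfl fun v hv => ?_
  simp [Function.update_of_ne (Finset.ne_of_mem_erase hv)]

/-- The sum over configurations is affine in the field at a vertex `u`, compatibly with weights
depending on the spin at `u`. -/
theorem exists_affine_coeff {V : Type*} [Fintype V] [DecidableEq V] (f : (V → Bool) → ℂ)
    (lam : V → ℂ) (u : V) :
    ∃ c : Bool → ℂ, ∀ (K : Bool → ℂ) (x : ℂ),
      ∑ σ, K (σ u) * f σ * fieldMonomial (Function.update lam u x) σ =
        K false * c false + K true * c true * x := by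
  refine ⟨fun i => ∑ σ, if σ u = i then f σ * fieldMonomial (Function.update lam u 1) σ else 0,
    fun K x => ?_⟩
  simp only [Finset.mul_sum, Finset.sum_mul, ← Finset.sum_add_distrib]
  refine Finset.sum_congr rfl fun σ _ => ?_
  rw [fieldMonomial_update]
  cases σ u <;> simp <;> ring

/-- The sum over configurations is bi-affine in the fields at distinct vertices `u` and `w`,
compatibly with weights depending on the spins at `u` and `w`. -/
theorem exists_biaffine_coeff {V : Type*} [Fintype V] [DecidableEq V] (f : (V → Bool) → ℂ)
    (lam : V → ℂ) {u w : V} (huw : u ≠ w) :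
    ∃ c : Bool → Bool → ℂ, ∀ (K : Bool → Bool → ℂ) (x y : ℂ),
      ∑ σ, K (σ u) (σ w) * f σ *
          fieldMonomial (Function.update (Function.update lam u x) w y) σ =
        K false false * c false false + K true false * c true false * x +
          K false true * c false true * y + K true true * c true true * x * y := by
  refine ⟨fun i j => ∑ σ, if σ u = i ∧ σ w = j then
    f σ * fieldMonomial (Function.update (Function.update lam u 1) w 1) σ else 0,
    fun K x y => ?_⟩
  simp only [Finset.mul_sum, Finset.sum_mul, ← Finset.sum_add_distrib]
  refine Finset.sum_congr rfl fun σ _ => ?_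
  rw [fieldMonomial_update, Function.update_comm huw, fieldMonomial_update,
    Function.update_comm huw.symm]
  cases σ u <;> cases σ w <;> simp <;> ring

section EdgeInsertion

variable {V : Type*} [Fintype V] [DecidableEq V] {β γ r : ℝ} {f : (V → Bool) → ℂ} {R : V → ℝ}

/-- Attaching a self-loop at `u` multiplies the zero-free radius at `u` by `r ^ 2`. -/
theorem sum_loop_ne_zero (hr : 0 < r)
    (hpoly : ∀ z₁ z₂ : ℂ, ‖z₁‖ < r → ‖z₂‖ < r → (γ : ℂ) * z₁ * z₂ + z₁ + z₂ + (β : ℂ) ≠ 0)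
    (hR : ∀ v, 0 < R v)
    (hf : ∀ lam : V → ℂ, (∀ v, ‖lam v‖ < R v) → ∑ σ, f σ * fieldMonomial lam σ ≠ 0)
    (u : V) (lam : V → ℂ) (hu : ‖lam u‖ < R u * (r * r)) (hlam : ∀ v, v ≠ u → ‖lam v‖ < R v) :
    ∑ σ, edgeW β γ (σ u) (σ u) * f σ * fieldMonomial lam σ ≠ 0 := by
  obtain ⟨c, hc⟩ := exists_affine_coeff f lam u
  have hP : ∀ x : ℂ, ‖x‖ < R u → c false + c true * x ≠ 0 := by
    intro x hx
    have := hf (Function.update lam u x) fun v => by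
      by_cases hv : v = u
      · subst hv; simpa using hx
      · simpa [hv] using hlam v hv
    have h := hc (fun _ => 1) x
    simp only [one_mul] at h
    rwa [h] at this
  have hE : ∀ z : ℂ, ‖z‖ < r * r → (β : ℂ) + γ * z ≠ 0 :=
    asano_contraction (b := 1) (c := 1) hr hr fun x y hx hy h0 =>
      hpoly x y hx hy (by rw [← h0]; ring)
  have key := asano_contraction (a := c false * β) (b := c true * β) (c := c false * γ)
    (d := c true * γ) (hR u) (mul_pos hr hr) (fun x y hx hy h0 =>
      mul_ne_zero (hP x hx) (hE y hy) (by rw [← h0]; ring)) (lam u) hu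
  have h := hc (fun i => edgeW β γ i i) (lam u)
  rw [Function.update_eq_self] at h
  rw [h]
  convert key using 1
  simp [edgeW]
  ring

/-- Attaching an edge between distinct vertices `u` and `w` multiplies the zero-free radii at `u`
and at `w` by `r`. -/
theorem sum_edge_ne_zero (hr : 0 < r)
    (hpoly : ∀ z₁ z₂ : ℂ, ‖z₁‖ < r → ‖z₂‖ < r → (γ : ℂ) * z₁ * z₂ + z₁ + z₂ + (β : ℂ) ≠ 0)
    (hR : ∀ v, 0 < R v)
    (hf : ∀ lam : V → ℂ, (∀ v, ‖lam v‖ < R v) → ∑ σ, f σ * fieldMonomial lam σ ≠ 0)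
    {u w : V} (huw : u ≠ w) (lam : V → ℂ) (hu : ‖lam u‖ < R u * r) (hw : ‖lam w‖ < R w * r)
    (hlam : ∀ v, v ≠ u → v ≠ w → ‖lam v‖ < R v) :
    ∑ σ, edgeW β γ (σ u) (σ w) * f σ * fieldMonomial lam σ ≠ 0 := by
  obtain ⟨c, hc⟩ := exists_biaffine_coeff f lam huw
  have hP : ∀ x y : ℂ, ‖x‖ < R u → ‖y‖ < R w →
      c false false + c true false * x + c false true * y + c true true * x * y ≠ 0 := by
    intro x y hx hy
    have := hf (Function.update (Function.update lam u x) w y) fun v => by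
      by_cases hv : v = w
      · subst hv; simpa using hy
      by_cases hv' : v = u
      · subst hv'; simpa [hv] using hx
      · simpa [hv, hv'] using hlam v hv' hv
    have h := hc (fun _ _ => 1) x y
    simp only [one_mul] at h
    rwa [h] at this
  -- contract the field at `u` with the first endpoint, then the field at `w` with the second
  have hfirst : ∀ y z : ℂ, ‖y‖ < R w → ‖z‖ < r →
      (c false false + c false true * y) * (β + z) +
        (c true false + c true true * y) * (1 + γ * z) * lam u ≠ 0 := fun y z hy hz =>
    asano_contraction (b := (c true false + c true true * y) * (β + z))
      (c := (c false false + c false true * y) * (1 + γ * z)) (hR u) hr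
      (fun x t hx ht h0 => mul_ne_zero (hP x y hx hy) (hpoly t z ht hz) (by rw [← h0]; ring))
      (lam u) hu
  have key := asano_contraction (a := c false false * β + c true false * lam u)
    (b := c false true * β + c true true * lam u)
    (c := c false false + c true false * γ * lam u)
    (d := c false true + c true true * γ * lam u) (hR w) hr
    (fun y z hy hz h0 => hfirst y z hy hz (by rw [← h0]; ring)) (lam w) hw
  have h := hc (edgeW β γ) (lam u) (lam w)
  rw [Function.update_eq_self, Function.update_eq_self] at h
  rw [h]
  convert key using 1
  simp [edgeW]
  ring

end EdgeInsertion

theorem degree_cons {n : ℕ} (e : Fin n × Fin n) (s : Multiset (Fin n × Fin n)) (v : Fin n) :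
    degree ⟨n, e ::ₘ s⟩ v =
      degree ⟨n, s⟩ v + ((if e.1 = v then 1 else 0) + (if e.2 = v then 1 else 0)) := by
  simp only [degree, Multiset.filter_cons, Multiset.card_add]
  split_ifs <;> simp <;> omega

theorem sum_fieldMonomial {V : Type*} [Fintype V] [DecidableEq V] (lam : V → ℂ) :
    ∑ σ, fieldMonomial lam σ = ∏ v, (1 + lam v) := by
  simp only [fieldMonomial]
  rw [← Fintype.prod_sum (fun v (b : Bool) => if b then lam v else 1)]
  simp [add_comm]

/-- If `γ z₁ z₂ + z₁ + z₂ + β` is nonzero for `|z₁|, |z₂| < r`, then for any graph `G`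
the partition function `Z_G(λ)` is nonzero whenever `|λ_v| < r^{deg_G(v)}` for all `v`. -/
theorem stmt8 (β γ r : ℝ) (hr : 0 < r)
    (hpoly : ∀ z₁ z₂ : ℂ, ‖z₁‖ < r → ‖z₂‖ < r →
      (γ : ℂ) * z₁ * z₂ + z₁ + z₂ + (β : ℂ) ≠ 0)
    (G : MultiGraph) (lam : Fin G.n → ℂ)
    (hlam : ∀ v : Fin G.n, ‖lam v‖ < r ^ degree G v) :
    ZC β γ G lam ≠ 0 := by
  obtain ⟨n, edges⟩ := G
  change ∑ σ : Fin n → Bool, (edges.map fun e => edgeW β γ (σ e.1) (σ e.2)).prod *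
    fieldMonomial lam σ ≠ 0
  induction edges using Multiset.induction_on with
  | empty =>
    simp only [Multiset.map_zero, Multiset.prod_zero, one_mul, sum_fieldMonomial]
    refine Finset.prod_ne_zero_iff.mpr fun v _ h0 => ?_
    have h1 := hlam v
    rw [eq_neg_of_add_eq_zero_right h0] at h1
    simp [degree] at h1
  | cons e s ih =>
    obtain ⟨u, w⟩ := e
    simp only [degree_cons, pow_add] at hlam
    simp only [Multiset.map_cons, Multiset.prod_cons]
    have hR : ∀ v : Fin n, 0 < r ^ degree ⟨n, s⟩ v := fun v => pow_pos hr _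
    by_cases huw : u = w
    · subst huw
      exact sum_loop_ne_zero hr hpoly hR ih u lam (by simpa using hlam u)
        fun v hv => by simpa [hv.symm] using hlam v
    · exact sum_edge_ne_zero hr hpoly hR ih huw lam (by simpa [Ne.symm huw] using hlam u)
        (by simpa [huw] using hlam w) fun v hv hv' => by simpa [hv.symm, hv'.symm] using hlam v
end
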